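/- arXiv:1603.07915 — 2 statements merged into one kernel-verified Lean document; each statement's English description precedes it below -/
import Mathlib

section
/- Let E be a complex normed space, U ⊆ E open, and Γ : E → (E →L[ℂ] E →L[ℂ] E) differentiable on U. Assume the torsion of the associated connection is parallel, i.e., (∇Tor)(p)(u)(v)(w) = 0 for all p ∈ U and u,v,w ∈ E. Then for any two vector fields Y, Z : E → E that are differentiable and horizontal on U, the Lie bracket [Y,Z] is horizontal on U: (D[Y,Z])ₚ(u) + Γ(p)(u)([Y,Z](p)) = 0 for all p ∈ U and u ∈ E. -/
open VectorField

variable {E : Type*} [NormedAddCommGroup E] [NormedSpace ℂ E]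

/-- The torsion of the connection with Christoffel map `Γ`. -/
noncomputable def torsion (Γ : E → (E →L[ℂ] E →L[ℂ] E)) (p : E) (u v : E) : E :=
  Γ p u v - Γ p v u

/-- The covariant derivative of the torsion of the connection with Christoffel map `Γ`. -/
noncomputable def nablaTorsion (Γ : E → (E →L[ℂ] E →L[ℂ] E)) (p : E) (u v w : E) : E :=
  fderiv ℂ (fun q => torsion Γ q v w) p u + Γ p u (torsion Γ p v w)
    - torsion Γ p (Γ p u v) w - torsion Γ p v (Γ p u w)

/-- The Leibniz rule for the torsion evaluated on two vector fields. -/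
theorem fderiv_torsion_apply {Γ : E → (E →L[ℂ] E →L[ℂ] E)}
    {Γ' : E →L[ℂ] E →L[ℂ] E →L[ℂ] E} {Y Z : E → E} {Y' Z' : E →L[ℂ] E} {p : E}
    (hΓ : HasFDerivAt Γ Γ' p) (hY : HasFDerivAt Y Y' p) (hZ : HasFDerivAt Z Z' p) (u : E) :
    fderiv ℂ (fun q => torsion Γ q (Y q) (Z q)) p u =
      Γ' u (Y p) (Z p) - Γ' u (Z p) (Y p)
        + torsion Γ p (Y' u) (Z p) + torsion Γ p (Y p) (Z' u) := by
  have h := ((hΓ.clm_apply hY).clm_apply hZ).sub ((hΓ.clm_apply hZ).clm_apply hY)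
  refine (congrArg (fun L : E →L[ℂ] E => L u) h.fderiv).trans ?_
  simp only [torsion, sub_apply, add_apply,
    ContinuousLinearMap.comp_apply, ContinuousLinearMap.flip_apply]
  abel

/-- The Lie bracket of two vector fields that are horizontal at `p` is minus their torsion. -/
theorem lieBracket_eq_neg_torsion {Γ : E → (E →L[ℂ] E →L[ℂ] E)} {Y Z : E → E} {p : E}
    (hY : ∀ u, fderiv ℂ Y p u + Γ p u (Y p) = 0) (hZ : ∀ u, fderiv ℂ Z p u + Γ p u (Z p) = 0) :
    lieBracket ℂ Y Z p = -torsion Γ p (Y p) (Z p) := by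
  rw [lieBracket, eq_neg_of_add_eq_zero_left (hY _), eq_neg_of_add_eq_zero_left (hZ _), torsion]
  abel

/-- Implication (3) ⇒ (1) of Proposition 3.8: if the torsion is parallel, then the Lie bracket
of two horizontal vector fields is horizontal. -/
theorem stmt3
    (U : Set E) (hU : IsOpen U)
    (Γ : E → (E →L[ℂ] E →L[ℂ] E)) (hΓ : ∀ p ∈ U, DifferentiableAt ℂ Γ p)
    (hTor : ∀ p ∈ U, ∀ u v w : E, nablaTorsion Γ p u v w = 0) :
    ∀ (Y Z : E → E),
      (∀ p ∈ U, DifferentiableAt ℂ Y p) → (∀ p ∈ U, DifferentiableAt ℂ Z p) →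
      (∀ p ∈ U, ∀ u : E, fderiv ℂ Y p u + Γ p u (Y p) = 0) →
      (∀ p ∈ U, ∀ u : E, fderiv ℂ Z p u + Γ p u (Z p) = 0) →
      ∀ p ∈ U, ∀ u : E,
        fderiv ℂ (lieBracket ℂ Y Z) p u + Γ p u (lieBracket ℂ Y Z p) = 0 := by
  intro Y Z hY hZ hYh hZh p hp u
  have hbr : lieBracket ℂ Y Z =ᶠ[nhds p] fun q => -torsion Γ q (Y q) (Z q) := by
    filter_upwards [hU.mem_nhds hp] with q hq
    exact lieBracket_eq_neg_torsion (hYh q hq) (hZh q hq)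
  have hΓp := (hΓ p hp).hasFDerivAt
  have hpar := hTor p hp u (Y p) (Z p)
  rw [nablaTorsion, fderiv_torsion_apply hΓp (hasFDerivAt_const (Y p) p)
    (hasFDerivAt_const (Z p) p)] at hpar
  rw [hbr.fderiv_eq, hbr.eq_of_nhds, fderiv_fun_neg, neg_apply,
    fderiv_torsion_apply hΓp (hY p hp).hasFDerivAt (hZ p hp).hasFDerivAt,
    eq_neg_of_add_eq_zero_left (hYh p hp u), eq_neg_of_add_eq_zero_left (hZh p hp u)]
  rw [← neg_eq_zero, ← hpar]
  simp only [torsion, map_neg, map_sub, map_zero, neg_apply,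
    zero_apply]
  abel
end

section
/- Let V ⊆ ℂ be open, ν : ℂ → ℂ differentiable on V, and a : ℂ → ℂ three times differentiable on V. On U = {(z₀,z₁,z₂) ∈ ℂ³ : z₀ ∈ V, z₁ ≠ 0} define E₋₁(z₀,z₁,z₂) = (z₁, z₂, −ν(z₀)z₁³ + (3/2)z₂²/z₁), E₀ = (0, z₁, 2z₂), E₁ = (0, 0, 2z₁), and Y(z₀,z₁,z₂) = (a(z₀), a'(z₀)·z₁, a''(z₀)·z₁² + a'(z₀)·z₂). Then at every point of U: [E₀,Y] = 0, [E₁,Y] = 0, and [E₋₁,Y](z₀,z₁,z₂) = (0, 0, z₁³·(a'''(z₀) + 2ν(z₀)a'(z₀) + ν'(z₀)a(z₀))). Consequently Y commutes with all three fields E₋₁, E₀, E₁ at (z₀,z₁,z₂) ∈ U if and only if a'''(z₀) + 2ν(z₀)a'(z₀) + ν'(z₀)a(z₀) = 0. -/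
open VectorField

lemma hasFDerivAt_snd_fst (w : ℂ × ℂ × ℂ) :
    HasFDerivAt (fun w : ℂ × ℂ × ℂ => w.2.1)
      ((ContinuousLinearMap.fst ℂ ℂ ℂ).comp (ContinuousLinearMap.snd ℂ ℂ (ℂ × ℂ))) w :=
  ((ContinuousLinearMap.fst ℂ ℂ ℂ).comp (ContinuousLinearMap.snd ℂ ℂ (ℂ × ℂ))).hasFDerivAt

lemma hasFDerivAt_snd_snd (w : ℂ × ℂ × ℂ) :
    HasFDerivAt (fun w : ℂ × ℂ × ℂ => w.2.2)
      ((ContinuousLinearMap.snd ℂ ℂ ℂ).comp (ContinuousLinearMap.snd ℂ ℂ (ℂ × ℂ))) w :=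
  ((ContinuousLinearMap.snd ℂ ℂ ℂ).comp (ContinuousLinearMap.snd ℂ ℂ (ℂ × ℂ))).hasFDerivAt

lemma hasFDerivAt_comp_fst {f : ℂ → ℂ} {w : ℂ × ℂ × ℂ} (hf : DifferentiableAt ℂ f w.1) :
    HasFDerivAt (fun w : ℂ × ℂ × ℂ => f w.1)
      (deriv f w.1 • ContinuousLinearMap.fst ℂ ℂ (ℂ × ℂ)) w :=
  hf.hasDerivAt.comp_hasFDerivAt w hasFDerivAt_fst

lemma fderiv_arcE0_apply (w v : ℂ × ℂ × ℂ) :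
    fderiv ℂ (fun w : ℂ × ℂ × ℂ => ((0 : ℂ), w.2.1, 2 * w.2.2)) w v =
      (0, v.2.1, 2 * v.2.2) := by
  rw [((hasFDerivAt_const (0 : ℂ) w).prodMk ((hasFDerivAt_snd_fst w).prodMk
    ((hasFDerivAt_snd_snd w).const_mul 2))).fderiv]
  simp

lemma fderiv_arcE1_apply (w v : ℂ × ℂ × ℂ) :
    fderiv ℂ (fun w : ℂ × ℂ × ℂ => ((0 : ℂ), (0 : ℂ), 2 * w.2.1)) w v =
      (0, 0, 2 * v.2.1) := by
  rw [((hasFDerivAt_const (0 : ℂ) w).prodMk ((hasFDerivAt_const (0 : ℂ) w).prodMk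
    ((hasFDerivAt_snd_fst w).const_mul 2))).fderiv]
  simp

lemma fderiv_arcEm1_apply {ν : ℂ → ℂ} {w : ℂ × ℂ × ℂ} (hν : DifferentiableAt ℂ ν w.1)
    (hw : w.2.1 ≠ 0) (v : ℂ × ℂ × ℂ) :
    fderiv ℂ (fun w : ℂ × ℂ × ℂ =>
        (w.2.1, w.2.2, - ν w.1 * w.2.1 ^ 3 + (3 / 2) * w.2.2 ^ 2 / w.2.1)) w v =
      (v.2.1, v.2.2, - deriv ν w.1 * v.1 * w.2.1 ^ 3 - 3 * ν w.1 * w.2.1 ^ 2 * v.2.1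
        + 3 * w.2.2 * v.2.2 / w.2.1 - (3 / 2) * w.2.2 ^ 2 * v.2.1 / w.2.1 ^ 2) := by
  have hinv := (hasDerivAt_inv hw).comp_hasFDerivAt w (hasFDerivAt_snd_fst w)
  have h := (hasFDerivAt_snd_fst w).prodMk ((hasFDerivAt_snd_snd w).prodMk
    (((hasFDerivAt_comp_fst hν).fun_neg.fun_mul ((hasFDerivAt_snd_fst w).pow 3)).fun_add
      ((((hasFDerivAt_snd_snd w).pow 2).const_mul (3 / 2)).fun_mul hinv)))
  simp only [div_eq_mul_inv _ (Prod.fst _)]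
  refine (congrArg (fun L => L v) h.fderiv).trans ?_
  ext <;> simp
  field_simp
  ring

lemma fderiv_prolongation_apply {a : ℂ → ℂ} {w : ℂ × ℂ × ℂ} (ha : DifferentiableAt ℂ a w.1)
    (ha' : DifferentiableAt ℂ (deriv a) w.1) (ha'' : DifferentiableAt ℂ (deriv (deriv a)) w.1)
    (v : ℂ × ℂ × ℂ) :
    fderiv ℂ (fun w : ℂ × ℂ × ℂ => (a w.1, deriv a w.1 * w.2.1,
        deriv (deriv a) w.1 * w.2.1 ^ 2 + deriv a w.1 * w.2.2)) w v =
      (deriv a w.1 * v.1, deriv (deriv a) w.1 * v.1 * w.2.1 + deriv a w.1 * v.2.1,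
        deriv (deriv (deriv a)) w.1 * v.1 * w.2.1 ^ 2
          + 2 * deriv (deriv a) w.1 * w.2.1 * v.2.1
          + deriv (deriv a) w.1 * v.1 * w.2.2 + deriv a w.1 * v.2.2) := by
  have h' := hasFDerivAt_comp_fst ha'
  have h := (hasFDerivAt_comp_fst ha).prodMk ((h'.fun_mul (hasFDerivAt_snd_fst w)).prodMk
    (((hasFDerivAt_comp_fst ha'').fun_mul ((hasFDerivAt_snd_fst w).pow 2)).fun_add
      (h'.fun_mul (hasFDerivAt_snd_snd w))))
  rw [h.fderiv]
  ext <;> simp <;> ring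

/-- The central computation in the proof of Theorem 5.6: the prolongation `Y` of a vector
field `a(z)∂/∂z` commutes with the `𝔰𝔩₂`-parallelism `E₋₁, E₀, E₁` on the variety of
Schwarzian arcs exactly when `a''' + 2νa' + ν'a = 0`. -/
theorem stmt10
    (V : Set ℂ) (hV : IsOpen V) (ν : ℂ → ℂ) (hν : ∀ z ∈ V, DifferentiableAt ℂ ν z)
    (a : ℂ → ℂ)
    (ha : ∀ z ∈ V, DifferentiableAt ℂ a z)
    (ha' : ∀ z ∈ V, DifferentiableAt ℂ (deriv a) z)
    (ha'' : ∀ z ∈ V, DifferentiableAt ℂ (deriv (deriv a)) z)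
    (Em1 E0 E1 Y : ℂ × ℂ × ℂ → ℂ × ℂ × ℂ)
    (hEm1 : Em1 = fun w =>
      (w.2.1, w.2.2, - ν w.1 * w.2.1 ^ 3 + (3 / 2) * w.2.2 ^ 2 / w.2.1))
    (hE0 : E0 = fun w => (0, w.2.1, 2 * w.2.2))
    (hE1 : E1 = fun w => (0, 0, 2 * w.2.1))
    (hY : Y = fun w => (a w.1, deriv a w.1 * w.2.1,
      deriv (deriv a) w.1 * w.2.1 ^ 2 + deriv a w.1 * w.2.2))
    (U : Set (ℂ × ℂ × ℂ)) (hU : U = {w : ℂ × ℂ × ℂ | w.1 ∈ V ∧ w.2.1 ≠ 0}) :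
    ∀ w ∈ U,
      (lieBracket ℂ E0 Y w = 0 ∧
       lieBracket ℂ E1 Y w = 0 ∧
       lieBracket ℂ Em1 Y w = (0, 0, w.2.1 ^ 3 *
         (deriv (deriv (deriv a)) w.1 + 2 * ν w.1 * deriv a w.1 + deriv ν w.1 * a w.1))) ∧
      ((lieBracket ℂ Em1 Y w = 0 ∧ lieBracket ℂ E0 Y w = 0 ∧ lieBracket ℂ E1 Y w = 0) ↔
        deriv (deriv (deriv a)) w.1 + 2 * ν w.1 * deriv a w.1 + deriv ν w.1 * a w.1 = 0) := by
  subst hEm1 hE0 hE1 hY hU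
  rintro w ⟨hwV, hw⟩
  have hDY := fderiv_prolongation_apply (ha _ hwV) (ha' _ hwV) (ha'' _ hwV)
  have h0 : lieBracket ℂ (fun w : ℂ × ℂ × ℂ => ((0 : ℂ), w.2.1, 2 * w.2.2))
      (fun w => (a w.1, deriv a w.1 * w.2.1,
        deriv (deriv a) w.1 * w.2.1 ^ 2 + deriv a w.1 * w.2.2)) w = 0 := by
    rw [lieBracket, hDY, fderiv_arcE0_apply]
    ext <;> simp
    ring
  have h1 : lieBracket ℂ (fun w : ℂ × ℂ × ℂ => ((0 : ℂ), (0 : ℂ), 2 * w.2.1))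
      (fun w => (a w.1, deriv a w.1 * w.2.1,
        deriv (deriv a) w.1 * w.2.1 ^ 2 + deriv a w.1 * w.2.2)) w = 0 := by
    rw [lieBracket, hDY, fderiv_arcE1_apply]
    ext <;> simp
    ring
  have hm1 : lieBracket ℂ (fun w : ℂ × ℂ × ℂ =>
        (w.2.1, w.2.2, - ν w.1 * w.2.1 ^ 3 + (3 / 2) * w.2.2 ^ 2 / w.2.1))
      (fun w => (a w.1, deriv a w.1 * w.2.1,
        deriv (deriv a) w.1 * w.2.1 ^ 2 + deriv a w.1 * w.2.2)) w = (0, 0, w.2.1 ^ 3 *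
      (deriv (deriv (deriv a)) w.1 + 2 * ν w.1 * deriv a w.1 + deriv ν w.1 * a w.1)) := by
    rw [lieBracket, hDY, fderiv_arcEm1_apply (hν _ hwV) hw]
    ext <;> simp
    · ring
    · field_simp
      ring
  refine ⟨⟨h0, h1, hm1⟩, ?_⟩
  rw [hm1]
  simp [h0, h1, hw]
end
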